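/- arXiv:1608.05091 — 2 statements merged into one kernel-verified Lean document; each statement's English description precedes it below -/
import Mathlib

section
/- Let (X,R) be a circularly ordered set and A ⊆ X. Let X_A := {a⁻, a⁺ : a ∈ A} ⊔ (X ∖ A) (each point of A is split in two) and let ν : X_A → X send a⁻ and a⁺ to a and fix every x ∈ X ∖ A. Define a ternary relation R_A on X_A by: (i) [p,q,r] whenever ν(p), ν(q), ν(r) are pairwise distinct and [ν(p),ν(q),ν(r)] holds in X; (ii) [a⁻, a⁺, u], [a⁺, u, a⁻], and [u, a⁻, a⁺] for every a ∈ A and every u ∈ X_A ∖ {a⁻, a⁺}. Then R_A is a circular order on X_A, the map ν is c-order preserving and continuous with respect to the interval topologies, ν^{-1}(a) has exactly two points for a ∈ A and is a singleton for a ∉ A, and if the interval topology of X is compact then so is the interval topology of X_A. -/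
/-- A circular order on a set `X`: a ternary relation satisfying cyclicity,
asymmetry, transitivity and totality. -/
structure CircularOrderRel (X : Type*) where
  rel : X → X → X → Prop
  cyclic : ∀ a b c, rel a b c → rel b c a
  asymm : ∀ a b c, rel a b c → ¬ rel a c b
  trans : ∀ a b c d, rel a b c → rel a c d → rel a b d
  total : ∀ a b c : X, a ≠ b → b ≠ c → a ≠ c → rel a b c ∨ rel a c b

/-- The interval topology of a ternary (circular order) relation: the topology
generated by the open intervals `(a,b) = {x | [a,x,b]}` for distinct `a, b`. -/
def intervalTopology {X : Type*} (r : X → X → X → Prop) : TopologicalSpace X :=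
  TopologicalSpace.generateFrom {s | ∃ a b : X, a ≠ b ∧ s = {x | r a x b}}

/-- The closed interval `[a,c]` of a circular order relation. -/
def closedArc {X : Type*} (r : X → X → X → Prop) (a c : X) : Set X :=
  {a, c} ∪ {x | r a x c}

/-- A map between circularly ordered sets is c-order preserving (COP). -/
def IsCOP {X Y : Type*} (r : X → X → X → Prop) (r' : Y → Y → Y → Prop)
    (f : X → Y) : Prop :=
  (∀ a b c : X, r a b c → f a ≠ f b → f b ≠ f c → f a ≠ f c → r' (f a) (f b) (f c)) ∧
  (∀ a c : X, f a = f c →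
    (∀ x ∈ closedArc r a c, f x = f a) ∨ (∀ x ∈ closedArc r c a, f x = f a))

/-- A sequence of real valued functions is independent. -/
def IsIndepSeq {X : Type*} (f : ℕ → X → ℝ) : Prop :=
  ∃ a b : ℝ, a < b ∧ ∀ P M : Finset ℕ, Disjoint P M →
    ((⋂ n ∈ P, {x | f n x < a}) ∩ (⋂ n ∈ M, {x | b < f n x})).Nonempty

/-- The standard circular order on `{0, 1, …, n-1}` (integers mod `n`). -/
def cyclicFin {n : ℕ} (i j k : Fin n) : Prop :=
  (i < j ∧ j < k) ∨ (j < k ∧ k < i) ∨ (k < i ∧ i < j)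

/-- A tuple `(x 0, …, x (n-1))` is a cycle in a circularly ordered set. -/
def IsCycle {X : Type*} (r : X → X → X → Prop) {n : ℕ} (x : Fin n → X) : Prop :=
  (∀ i j k : Fin n, cyclicFin i j k → x i ≠ x j → x j ≠ x k → x i ≠ x k →
      r (x i) (x j) (x k)) ∧
  (∀ i k : Fin n, x i = x k →
    (∀ j : Fin n, (j = i ∨ j = k ∨ cyclicFin i j k) → x j = x i) ∨
    (∀ j : Fin n, (j = i ∨ j = k ∨ cyclicFin k j i) → x j = x i))

/-- `f` has cyclic variation at most `v`. -/
def CyclicVariationLe {X : Type*} (r : X → X → X → Prop) (f : X → ℝ) (v : ℝ) : Prop :=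
  ∀ (n : ℕ) (x : Fin (n + 1) → X), IsCycle r x →
    ∑ i : Fin (n + 1), |f (x i) - f (x (i + 1))| ≤ v

/-- The split space `X_A`: every point `a ∈ A` is doubled into
`a⁻ = (a, false)` and `a⁺ = (a, true)`, while points outside `A` appear
once (with tag `false`). -/
def SplitSpace {X : Type*} (A : Set X) : Type _ :=
  {p : X × Bool // p.1 ∈ A ∨ p.2 = false}

/-- The canonical projection `ν : X_A → X`. -/
def splitProj {X : Type*} (A : Set X) : SplitSpace A → X := fun p => p.1.1

/-- The circular order relation `R_A` on the split space `X_A`: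
(i) triples with pairwise distinct projections inherit the order of `X`;
(ii) `[a⁻, a⁺, u]`, `[a⁺, u, a⁻]`, `[u, a⁻, a⁺]` for `a ∈ A` and
`u ∉ {a⁻, a⁺}`. -/
def splitRel {X : Type*} (R : CircularOrderRel X) (A : Set X)
    (p q r : SplitSpace A) : Prop :=
  (splitProj A p ≠ splitProj A q ∧ splitProj A q ≠ splitProj A r ∧
    splitProj A p ≠ splitProj A r ∧
    R.rel (splitProj A p) (splitProj A q) (splitProj A r)) ∨
  (∃ a ∈ A, p.1 = (a, false) ∧ q.1 = (a, true) ∧ splitProj A r ≠ a) ∨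
  (∃ a ∈ A, q.1 = (a, false) ∧ r.1 = (a, true) ∧ splitProj A p ≠ a) ∨
  (∃ a ∈ A, r.1 = (a, false) ∧ p.1 = (a, true) ∧ splitProj A q ≠ a)

namespace CircularOrderRel

variable {X : Type*} (R : CircularOrderRel X)

theorem ne_of_rel (a b c : X) (h : R.rel a b c) : a ≠ b ∧ b ≠ c ∧ a ≠ c := by
  have ne_left {a b c : X} (h : R.rel a b c) : a ≠ b := by
    rintro rfl
    have h' := R.cyclic _ _ _ (R.cyclic _ _ _ h)
    exact R.asymm _ _ _ h' h'
  have h' := R.cyclic _ _ _ h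
  exact ⟨ne_left h, ne_left h', (ne_left (R.cyclic _ _ _ h')).symm⟩

theorem ne_left {a b c : X} (h : R.rel a b c) : a ≠ b := (R.ne_of_rel a b c h).1

theorem ne_right {a b c : X} (h : R.rel a b c) : b ≠ c := (R.ne_of_rel a b c h).2.1

theorem ne_outer {a b c : X} (h : R.rel a b c) : a ≠ c := (R.ne_of_rel a b c h).2.2

theorem isOpen_interval {a b : X} (h : a ≠ b) :
    @IsOpen X (intervalTopology R.rel) {x | R.rel a x b} :=
  TopologicalSpace.isOpen_generateFrom_of_mem ⟨a, b, h, rfl⟩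

end CircularOrderRel

theorem le_nhds_intervalTopology {X : Type*} {r : X → X → X → Prop} {F : Filter X} {x : X}
    (h : ∀ a b, a ≠ b → r a x b → {y | r a y b} ∈ F) :
    F ≤ @nhds X (intervalTopology r) x := by
  rw [intervalTopology, TopologicalSpace.nhds_generateFrom]
  refine le_iInf₂ ?_
  rintro _ ⟨hx, a, b, hab, rfl⟩
  exact Filter.le_principal_iff.2 (h a b hab hx)

namespace SplitSpace

variable {X : Type*} {A : Set X}

theorem ext {p q : SplitSpace A} (h : splitProj A p = splitProj A q) (h' : p.1.2 = q.1.2) :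
    p = q :=
  Subtype.ext (Prod.ext h h')

theorem splitRel_iff (R : CircularOrderRel X) (p q r : SplitSpace A) :
    splitRel R A p q r ↔
      R.rel (splitProj A p) (splitProj A q) (splitProj A r) ∨
      (splitProj A p = splitProj A q ∧ splitProj A r ≠ splitProj A p ∧
        p.1.2 = false ∧ q.1.2 = true) ∨
      (splitProj A q = splitProj A r ∧ splitProj A p ≠ splitProj A q ∧
        q.1.2 = false ∧ r.1.2 = true) ∨
      (splitProj A r = splitProj A p ∧ splitProj A q ≠ splitProj A r ∧
        r.1.2 = false ∧ p.1.2 = true) := by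
  have := R.ne_of_rel (splitProj A p) (splitProj A q) (splitProj A r)
  obtain ⟨⟨x, i⟩, hp⟩ := p
  obtain ⟨⟨y, j⟩, hq⟩ := q
  obtain ⟨⟨z, k⟩, hr⟩ := r
  simp only [splitRel, splitProj, Prod.mk.injEq] at *
  grind (splits := 20)

/-- The circular order on the split space. -/
def circularOrder (R : CircularOrderRel X) (A : Set X) : CircularOrderRel (SplitSpace A) where
  rel := splitRel R A
  cyclic p q r := by
    simp only [splitRel_iff]
    have := R.cyclic (splitProj A p) (splitProj A q) (splitProj A r)
    grind
  asymm p q r := by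
    simp only [splitRel_iff]
    have := R.asymm (splitProj A p) (splitProj A q) (splitProj A r)
    have := R.ne_of_rel (splitProj A p) (splitProj A q) (splitProj A r)
    have := R.ne_of_rel (splitProj A p) (splitProj A r) (splitProj A q)
    grind
  trans p q r s := by
    simp only [splitRel_iff]
    have := R.trans (splitProj A p) (splitProj A q) (splitProj A r) (splitProj A s)
    have := R.ne_of_rel (splitProj A p) (splitProj A q) (splitProj A r)
    have := R.ne_of_rel (splitProj A p) (splitProj A r) (splitProj A s)
    have := R.asymm (splitProj A p) (splitProj A q) (splitProj A r)
    grind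
  total p q r hpq hqr hpr := by
    simp only [splitRel_iff]
    have := R.total (splitProj A p) (splitProj A q) (splitProj A r)
    have := fun h => mt (ext (p := p) (q := q) h) hpq
    have := fun h => mt (ext (p := q) (q := r) h) hqr
    have := fun h => mt (ext (p := p) (q := r) h) hpr
    have hp := Bool.eq_false_or_eq_true p.1.2
    have hq := Bool.eq_false_or_eq_true q.1.2
    have hr := Bool.eq_false_or_eq_true r.1.2
    grind (splits := 20)

theorem isCOP_splitProj (R : CircularOrderRel X) (A : Set X) :
    IsCOP (splitRel R A) R.rel (splitProj A) := by
  constructor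
  · intro p q r
    rw [splitRel_iff]
    grind
  · intro p q h
    by_cases hpq : p.1.2 = true ∧ q.1.2 = false
    · right
      rintro x ((rfl | rfl) | hx)
      · exact h.symm
      · rfl
      · have := R.ne_of_rel (splitProj A q) (splitProj A x) (splitProj A p)
        have := (splitRel_iff R _ _ _).1 hx
        grind
    · left
      rintro x ((rfl | rfl) | hx)
      · rfl
      · exact h.symm
      · have := R.ne_of_rel (splitProj A p) (splitProj A x) (splitProj A q)
        have := (splitRel_iff R _ _ _).1 hx
        grind

theorem continuous_splitProj (R : CircularOrderRel X) (A : Set X) :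
    @Continuous _ _ (intervalTopology (splitRel R A)) (intervalTopology R.rel)
      (splitProj A) := by
  let := intervalTopology (splitRel R A)
  refine continuous_generateFrom_iff.2 ?_
  rintro _ ⟨a, b, hab, rfl⟩
  obtain ⟨p, hp, hpA⟩ : ∃ p : SplitSpace A, splitProj A p = a ∧ (p.1.2 = false → a ∉ A) := by
    by_cases ha : a ∈ A
    · exact ⟨⟨(a, true), .inl ha⟩, rfl, by simp⟩
    · exact ⟨⟨(a, false), .inr rfl⟩, rfl, fun _ => ha⟩
  let q : SplitSpace A := ⟨(b, false), .inr rfl⟩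
  have hq : splitProj A q = b := rfl
  have hq' : q.1.2 = false := rfl
  have : splitProj A ⁻¹' {x | R.rel a x b} = {x | splitRel R A p x q} := by
    ext x
    have hx : x.1.2 = true → splitProj A x ∈ A := fun h => x.2.resolve_right (by simp [h])
    simp only [Set.mem_preimage, Set.mem_ofPred_eq, splitRel_iff]
    grind
  rw [this]
  exact (circularOrder R A).isOpen_interval (fun h => hab (by rw [← hp, h, hq]))

theorem preimage_splitProj_of_mem {a : X} (ha : a ∈ A) :
    splitProj A ⁻¹' {a} = {⟨(a, false), .inr rfl⟩, ⟨(a, true), .inl ha⟩} := by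
  ext p
  constructor
  · intro hp
    cases hi : p.1.2
    · exact .inl (ext hp hi)
    · exact .inr (ext hp hi)
  · rintro (rfl | rfl) <;> rfl

theorem preimage_splitProj_of_notMem {a : X} (ha : a ∉ A) :
    splitProj A ⁻¹' {a} = {⟨(a, false), .inr rfl⟩} := by
  ext p
  constructor
  · intro hp
    exact ext hp (p.2.resolve_left fun h => ha (Set.mem_singleton_iff.1 hp ▸ h))
  · rintro rfl
    rfl

theorem compactSpace_intervalTopology (R : CircularOrderRel X) (A : Set X)
    (hX : @CompactSpace X (intervalTopology R.rel)) :
    @CompactSpace _ (intervalTopology (splitRel R A)) := by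
  let := intervalTopology R.rel
  let := intervalTopology (splitRel R A)
  rcases finite_or_infinite X with hfin | hinf
  · have : Finite (SplitSpace A) := inferInstanceAs (Finite {p : X × Bool // _})
    infer_instance
  refine ⟨isCompact_iff_ultrafilter_le_nhds.2 fun F _ => ?_⟩
  obtain ⟨x, -, hx⟩ := isCompact_iff_ultrafilter_le_nhds.1 isCompact_univ
    (F.map (splitProj A)) (by simp)
  have interval_mem {a b : X} (h : R.rel a x b) : ∀ᶠ p in F, R.rel a (splitProj A p) b :=
    hx ((R.isOpen_interval (R.ne_outer h)).mem_nhds h)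
  have ne_mem {e : X} (he : e ≠ x) : ∀ᶠ p in F, splitProj A p ≠ e := by
    classical
    obtain ⟨y, hy⟩ := Infinite.exists_notMem_finset ({e, x} : Finset X)
    simp only [Finset.mem_insert, Finset.mem_singleton, not_or] at hy
    rcases R.total e x y he (Ne.symm hy.2) (Ne.symm hy.1) with h | h
    · exact (interval_mem h).mono fun p hp => (R.ne_left hp).symm
    · exact (interval_mem (R.cyclic _ _ _ h)).mono fun p hp => R.ne_right hp
  have far {c q d : SplitSpace A} (hq : splitProj A q = x) (hc : splitProj A c ≠ x)
      (hd : splitProj A d ≠ x) (h : splitRel R A c q d) : ∀ᶠ p in F, splitRel R A c p d := by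
    simp only [splitRel_iff] at h ⊢
    by_cases hcd : R.rel (splitProj A c) x (splitProj A d)
    · exact (interval_mem hcd).mono fun p hp => .inl hp
    · filter_upwards [ne_mem hd] with p hp
      grind
  by_cases hxA : x ∉ A
  · refine ⟨⟨(x, false), .inr rfl⟩, trivial, le_nhds_intervalTopology fun c d _ h => ?_⟩
    have aux (c : SplitSpace A) (hc : splitProj A c = x) : c = ⟨(x, false), .inr rfl⟩ := by
      have : c ∈ splitProj A ⁻¹' {x} := hc
      rwa [preimage_splitProj_of_notMem hxA] at this
    refine far rfl (fun hc => ?_) (fun hd => ?_) h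
    · exact (circularOrder R A).ne_left h (aux c hc)
    · exact (circularOrder R A).ne_right h (aux d hd).symm
  rw [not_not] at hxA
  by_cases hF : ∀ᶠ p in F, splitProj A p = x
  · have : splitProj A ⁻¹' {x} ∈ F := hF
    obtain ⟨p, -, hp⟩ := Ultrafilter.eq_pure_of_finite_mem
      (by rw [preimage_splitProj_of_mem hxA]; exact (Set.finite_singleton _).insert _) this
    exact ⟨p, trivial, hp ▸ pure_le_nhds p⟩
  rw [← Ultrafilter.eventually_not] at hF
  obtain ⟨y, hy⟩ := exists_ne x
  have hsides : ∀ᶠ p in F, R.rel x (splitProj A p) y ∨ R.rel y (splitProj A p) x := by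
    filter_upwards [hF, ne_mem hy] with p hpx hpy
    exact (R.total _ _ _ (Ne.symm hpx) hpy hy.symm).imp_right fun h => R.cyclic _ _ _ h
  rcases Ultrafilter.eventually_or.1 hsides with hs | hs
  · refine ⟨⟨(x, true), .inl hxA⟩, trivial, le_nhds_intervalTopology fun c d _ h => ?_⟩
    set q : SplitSpace A := ⟨(x, true), .inl hxA⟩
    have hq : splitProj A q = x := rfl
    have hq' : q.1.2 = true := rfl
    have h' := (splitRel_iff R _ _ _).1 h
    have := R.ne_of_rel (splitProj A c) (splitProj A q) (splitProj A d)
    have hd : splitProj A d ≠ x := by grind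
    by_cases hc : splitProj A c = x
    · have key : ∀ᶠ p in F, R.rel x (splitProj A p) (splitProj A d) := by
        rcases eq_or_ne (splitProj A d) y with hdy | hdy
        · rwa [hdy]
        rcases R.total x y (splitProj A d) hy.symm hdy.symm hd.symm with hyd | hyd
        · exact hs.mono fun p hp => R.trans _ _ _ _ hp hyd
        · filter_upwards [hs, interval_mem (R.cyclic _ _ _ (R.cyclic _ _ _ hyd))] with p hp hp'
          exact R.cyclic _ _ _ (R.cyclic _ _ _
            (R.trans _ _ _ _ (R.cyclic _ _ _ hp') (R.cyclic _ _ _ hp)))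
      exact key.mono fun p hp => (splitRel_iff R _ _ _).2 (.inl (hc ▸ hp))
    · exact far hq hc hd h
  · refine ⟨⟨(x, false), .inr rfl⟩, trivial, le_nhds_intervalTopology fun c d _ h => ?_⟩
    set q : SplitSpace A := ⟨(x, false), .inr rfl⟩
    have hq : splitProj A q = x := rfl
    have hq' : q.1.2 = false := rfl
    have h' := (splitRel_iff R _ _ _).1 h
    have := R.ne_of_rel (splitProj A c) (splitProj A q) (splitProj A d)
    have hc : splitProj A c ≠ x := by grind
    by_cases hd : splitProj A d = x
    · have key : ∀ᶠ p in F, R.rel (splitProj A c) (splitProj A p) x := by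
        rcases eq_or_ne (splitProj A c) y with hcy | hcy
        · rwa [hcy]
        rcases R.total x (splitProj A c) y hc.symm hcy hy.symm with hyc | hyc
        · exact hs.mono fun p hp => R.cyclic _ _ _
            (R.trans _ _ _ _ hyc (R.cyclic _ _ _ (R.cyclic _ _ _ hp)))
        · filter_upwards [hs, interval_mem (R.cyclic _ _ _ (R.cyclic _ _ _ hyc))] with p hp hp'
          exact R.cyclic _ _ _ (R.cyclic _ _ _
            (R.trans _ _ _ _ (R.cyclic _ _ _ hp) (R.cyclic _ _ _ hp')))
      exact key.mono fun p hp => (splitRel_iff R _ _ _).2 (.inl (hd ▸ hp))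
    · exact far hq hc hd h

end SplitSpace

/-- The relation `R_A` is a circular order on the split space
`X_A`, the projection `ν : X_A → X` is c-order preserving and continuous for
the interval topologies, its fibers over points of `A` have exactly two
points and all other fibers are singletons, and if the interval topology of
`X` is compact then so is that of `X_A`. -/
theorem split_space_properties {X : Type*} (R : CircularOrderRel X) (A : Set X) :
    ∃ RA : CircularOrderRel (SplitSpace A),
      RA.rel = splitRel R A ∧
      IsCOP RA.rel R.rel (splitProj A) ∧
      @Continuous (SplitSpace A) X (intervalTopology RA.rel)
        (intervalTopology R.rel) (splitProj A) ∧
      (∀ a ∈ A, ∃ p q : SplitSpace A, p ≠ q ∧ splitProj A ⁻¹' {a} = {p, q}) ∧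
      (∀ x ∉ A, ∃ p : SplitSpace A, splitProj A ⁻¹' {x} = {p}) ∧
      (@CompactSpace X (intervalTopology R.rel) →
        @CompactSpace (SplitSpace A) (intervalTopology RA.rel)) := by
  refine ⟨SplitSpace.circularOrder R A, rfl, SplitSpace.isCOP_splitProj R A,
    SplitSpace.continuous_splitProj R A,
    fun a ha => ⟨_, _, ?_, SplitSpace.preimage_splitProj_of_mem ha⟩,
    fun x hx => ⟨_, SplitSpace.preimage_splitProj_of_notMem hx⟩,
    SplitSpace.compactSpace_intervalTopology R A⟩
  exact fun h => Bool.false_ne_true (congrArg (fun p => p.1.2) h)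
end

section
/- Let γ : M → X be a c-order preserving surjection between circularly ordered sets and A ⊆ X a subset such that γ^{-1}(a) has exactly two points for every a ∈ A and γ^{-1}(x) is a singleton for every x ∈ X ∖ A. Then for every a ∈ A with γ^{-1}(a) = {a₁, a₂}, either [a₁, a₂, v] holds for every v ∈ M ∖ {a₁, a₂}, or [a₂, a₁, v] holds for every v ∈ M ∖ {a₁, a₂}. (Hence the circular order on M is uniquely determined by γ and the circular order on X.) -/
/-- In a circular order, if the closed arc from `p` to `q` lies in `{p, q}`, then every other
point `v` satisfies `[p, q, v]`. -/
theorem CircularOrderRel.rel_of_closedArc_subset_pair {M : Type*} (R : CircularOrderRel M)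
    {p q : M} (hpq : p ≠ q) (h : closedArc R.rel p q ⊆ {p, q}) {v : M}
    (hp : v ≠ p) (hq : v ≠ q) : R.rel p q v := by
  refine (R.total p q v hpq hq.symm hp.symm).resolve_right fun hv ↦ ?_
  rcases h (Or.inr hv) with rfl | rfl
  exacts [hp rfl, hq rfl]

/-- Uniqueness of the circular order of a split space. If
`γ : M → X` is a c-order preserving surjection of circularly ordered sets
whose fibers over points of `A` are doubletons and all other fibers are
singletons, then for each `a ∈ A` with `γ⁻¹(a) = {a₁, a₂}` either
`[a₁, a₂, v]` for all `v ∉ {a₁, a₂}` or `[a₂, a₁, v]` for all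
`v ∉ {a₁, a₂}`. -/
theorem split_circular_order_unique
    {M X : Type*} (RM : CircularOrderRel M) (RX : CircularOrderRel X)
    (γ : M → X) (hsurj : Function.Surjective γ)
    (hcop : IsCOP RM.rel RX.rel γ)
    (A : Set X)
    (htwo : ∀ a ∈ A, ∃ p q : M, p ≠ q ∧ γ ⁻¹' {a} = {p, q})
    (hone : ∀ x ∉ A, ∃ p : M, γ ⁻¹' {x} = {p})
    (a : X) (ha : a ∈ A)
    (a₁ a₂ : M) (h12 : a₁ ≠ a₂) (hfiber : γ ⁻¹' {a} = {a₁, a₂}) :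
    (∀ v : M, v ≠ a₁ → v ≠ a₂ → RM.rel a₁ a₂ v) ∨
    (∀ v : M, v ≠ a₁ → v ≠ a₂ → RM.rel a₂ a₁ v) := by
  have mem_fiber : ∀ {x}, γ x = a → x ∈ ({a₁, a₂} : Set M) := fun hx ↦ hfiber ▸ hx
  have h₁ : γ a₁ = a := (hfiber ▸ Or.inl rfl : a₁ ∈ γ ⁻¹' {a})
  have h₂ : γ a₂ = a := (hfiber ▸ Or.inr rfl : a₂ ∈ γ ⁻¹' {a})
  refine (hcop.2 a₁ a₂ (h₁.trans h₂.symm)).imp (fun h v hv₁ hv₂ ↦ ?_) (fun h v hv₁ hv₂ ↦ ?_)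
  · exact RM.rel_of_closedArc_subset_pair h12
      (fun x hx ↦ mem_fiber ((h x hx).trans h₁)) hv₁ hv₂
  · exact RM.rel_of_closedArc_subset_pair h12.symm
      (fun x hx ↦ (mem_fiber ((h x hx).trans h₁)).symm) hv₂ hv₁
end
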